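/- arXiv:math/0503137 — 2 statements merged into one kernel-verified Lean document; each statement's English description precedes it below -/
import Mathlib

section
/- Fix p > 1 and s = p − 1. Let T be an infinite, locally finite rooted tree with root o and no leaves except possibly o, let {a_v : v ≠ o} be positive constants, and assign to the edge from the parent of v to v the resistance R_v = Π_{o < y ≤ v} a_y^{-1}. (a) If κ₁ > 0 and f_v(x) ≤ a_v x / (1 + (κ₁ x)^s)^{1/s} for all v ≠ o and x ≥ 0, then any family of nonnegative reals {x_v} with x_v ≤ Σ_{v → w} f_w(x_w) for all v satisfies x_o ≤ cap_p(T) / κ₁; in particular, if cap_p(T) = 0 there are no nontrivial such families. (b) If κ₂ > 0, a_v x / (1 + (κ₂ x)^s)^{1/s} ≤ f_v(x) for all v ≠ o and x ≥ 0, and cap_p(T) > 0, then the family x_v := R_v · cap_p(T(v)) / κ₂ (with R_o = 1, and T(v) retaining the resistances R_w) satisfies x_v ≤ Σ_{v → w} f_w(x_w) for all v, and x_o ≥ cap_p(T) / κ₂. -/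
open scoped ENNReal Classical

noncomputable section

/-- Vertices of the canonical rooted tree: finite sequences of naturals; the root is `[]`. -/
abbrev Vtx := List ℕ

/-- Vertices of the tree determined by the child-count function `c`. -/
inductive IsVtx (c : Vtx → ℕ) : Vtx → Prop
  | root : IsVtx c []
  | child {v : Vtx} {i : ℕ} : IsVtx c v → i < c v → IsVtx c (v ++ [i])

/-- A flow: conservation at every non-root, non-leaf vertex (edges are identified with their
lower endpoints). -/
def IsFlow (c : Vtx → ℕ) (μ : Vtx → ℝ≥0∞) : Prop :=
  ∀ v : Vtx, IsVtx c v → v ≠ [] → c v ≠ 0 →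
    μ v = ∑ i ∈ Finset.range (c v), μ (v ++ [i])

/-- Total flow out of the root. -/
def flowMass (c : Vtx → ℕ) (μ : Vtx → ℝ≥0∞) : ℝ≥0∞ :=
  ∑ i ∈ Finset.range (c []), μ [i]

/-- An infinite ray from the root. -/
def IsRay (c : Vtx → ℕ) (y : ℕ → ℕ) : Prop :=
  ∀ n : ℕ, y n < c ((List.range n).map y)

/-- `V_μ(y) = Σ_{e ∈ y} (μ(e) R(e))^s` along an infinite ray. -/
def rayPot (μ R : Vtx → ℝ≥0∞) (s : ℝ) (y : ℕ → ℕ) : ℝ≥0∞ :=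
  ∑' n : ℕ, (μ ((List.range (n + 1)).map y) * R ((List.range (n + 1)).map y)) ^ s

/-- `V_μ` along the maximal path from the root to a leaf `ℓ`. -/
def leafPot (μ R : Vtx → ℝ≥0∞) (s : ℝ) (ℓ : Vtx) : ℝ≥0∞ :=
  ∑ k ∈ Finset.range ℓ.length, (μ (ℓ.take (k + 1)) * R (ℓ.take (k + 1))) ^ s

/-- `cap_p` of an infinite leafless tree. -/
def capInf (c : Vtx → ℕ) (R : Vtx → ℝ≥0∞) (p : ℝ) : ℝ≥0∞ :=
  sSup {m | ∃ μ : Vtx → ℝ≥0∞, IsFlow c μ ∧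
    (∀ y : ℕ → ℕ, IsRay c y → rayPot μ R (p - 1) y ≤ 1) ∧ m = flowMass c μ}

/-- `cap_p` of a finite tree. -/
def capFin (c : Vtx → ℕ) (R : Vtx → ℝ≥0∞) (p : ℝ) : ℝ≥0∞ :=
  sSup {m | ∃ μ : Vtx → ℝ≥0∞, IsFlow c μ ∧
    (∀ ℓ : Vtx, IsVtx c ℓ → c ℓ = 0 → leafPot μ R (p - 1) ℓ ≤ 1) ∧ m = flowMass c μ}

/-- Extension of `f : [0,∞) → [0,∞)` to `ℝ≥0∞` via `f(∞) := liminf_{x → ∞} f(x)`. -/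
def extLiminf (f : ℝ → ℝ) : ℝ≥0∞ → ℝ≥0∞ := fun t =>
  if t = ⊤ then ENNReal.ofReal (Filter.liminf f Filter.atTop)
  else ENNReal.ofReal (f t.toReal)

/-- The product of `φ` over the edges of the path from the root to `v`. -/
def pathProd (φ : Vtx → ℝ) (v : Vtx) : ℝ :=
  ∏ k ∈ Finset.range v.length, φ (v.take (k + 1))

lemma prod_range_take_append_singleton {M : Type*} [CommMonoid M] (φ : Vtx → M) (v : Vtx)
    (i : ℕ) :
    ∏ k ∈ Finset.range (v ++ [i]).length, φ ((v ++ [i]).take (k + 1)) =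
      (∏ k ∈ Finset.range v.length, φ (v.take (k + 1))) * φ (v ++ [i]) := by
  rw [List.length_append, List.length_singleton, Finset.prod_range_succ]
  congr 1
  · refine Finset.prod_congr rfl fun k hk => ?_
    rw [List.take_append_of_le_length (Finset.mem_range.1 hk)]
  · rw [List.take_of_length_le (by simp)]

@[simp] lemma pathProd_nil (φ : Vtx → ℝ) : pathProd φ [] = 1 := by
  simp [pathProd]

@[simp] lemma pathProd_append_singleton (φ : Vtx → ℝ) (v : Vtx) (i : ℕ) :
    pathProd φ (v ++ [i]) = pathProd φ v * φ (v ++ [i]) :=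
  prod_range_take_append_singleton φ v i

lemma map_range_succ (y : ℕ → ℕ) (n : ℕ) :
    (List.range (n + 1)).map y = (List.range n).map y ++ [y n] := by
  simp [List.range_succ]

lemma IsRay.isVtx {c : Vtx → ℕ} {y : ℕ → ℕ} (h : IsRay c y) (n : ℕ) :
    IsVtx c ((List.range n).map y) := by
  induction n with
  | zero => exact IsVtx.root
  | succ n ih => rw [map_range_succ]; exact ih.child (h n)

lemma IsVtx.append {c : Vtx → ℕ} {v w : Vtx} (hv : IsVtx c v)
    (hw : IsVtx (fun w => c (v ++ w)) w) : IsVtx c (v ++ w) := by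
  induction hw with
  | root => simpa using hv
  | child _ hi ih => rw [← List.append_assoc]; exact ih.child hi

lemma pathProd_pos {c : Vtx → ℕ} {a : Vtx → ℝ} (ha : ∀ v, IsVtx c v → v ≠ [] → 0 < a v)
    {v : Vtx} (hv : IsVtx c v) : 0 < pathProd a v := by
  induction hv with
  | root => simp
  | child hv hi ih =>
    rw [pathProd_append_singleton]
    exact mul_pos ih (ha _ (hv.child hi) (by simp))

lemma prod_ofReal_eq_ofReal_pathProd {c : Vtx → ℕ} {a : Vtx → ℝ}
    (ha : ∀ v, IsVtx c v → v ≠ [] → 0 < a v) {v : Vtx} (hv : IsVtx c v) :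
    ∏ k ∈ Finset.range v.length, ENNReal.ofReal (a (v.take (k + 1))) =
      ENNReal.ofReal (pathProd a v) := by
  induction hv with
  | root => simp
  | child hv hi ih =>
    rw [prod_range_take_append_singleton (fun w => ENNReal.ofReal (a w)), ih,
      pathProd_append_singleton, ENNReal.ofReal_mul (pathProd_pos ha hv).le]

/-- The ray that first visits the child `i` of the root and then follows `y`. -/
def consRay (i : ℕ) (y : ℕ → ℕ) : ℕ → ℕ
  | 0 => i
  | n + 1 => y n

lemma map_consRay (i : ℕ) (y : ℕ → ℕ) (n : ℕ) :
    (List.range (n + 1)).map (consRay i y) = [i] ++ (List.range n).map y := by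
  simp [List.range_succ_eq_map, consRay, Function.comp_def]

lemma IsRay.consRay {c : Vtx → ℕ} {i : ℕ} {y : ℕ → ℕ} (hi : i < c [])
    (hy : IsRay (fun w => c ([i] ++ w)) y) : IsRay c (consRay i y) := by
  rintro (_ | n)
  · exact hi
  · rw [map_consRay]; exact hy n

lemma rayPot_consRay (μ R : Vtx → ℝ≥0∞) (s : ℝ) (i : ℕ) (y : ℕ → ℕ) :
    rayPot μ R s (consRay i y) =
      (μ [i] * R [i]) ^ s +
        rayPot (fun w => μ ([i] ++ w)) (fun w => R ([i] ++ w)) s y := by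
  unfold rayPot
  rw [tsum_eq_zero_add' ENNReal.summable]
  simp only [map_consRay]
  simp

lemma isRay_zero {c : Vtx → ℕ} (hc : ∀ v, IsVtx c v → 1 ≤ c v) : IsRay c fun _ => 0 := by
  have h : ∀ n, IsVtx c ((List.range n).map fun _ => 0) := by
    intro n
    induction n with
    | zero => exact IsVtx.root
    | succ n ih => rw [map_range_succ]; exact ih.child (hc _ ih)
  exact fun n => hc _ (h n)

lemma leafless_subtree {c : Vtx → ℕ} (hc : ∀ v, IsVtx c v → 1 ≤ c v) {v : Vtx}
    (hv : IsVtx c v) : ∀ w, IsVtx (fun w => c (v ++ w)) w → 1 ≤ c (v ++ w) :=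
  fun _ hw => hc _ (hv.append hw)

lemma capInf_ne_top {p : ℝ} (hp : 1 < p) {c : Vtx → ℕ} (hc : ∀ v, IsVtx c v → 1 ≤ c v)
    {R : Vtx → ℝ≥0∞} (hR : ∀ i < c [], R [i] ≠ 0) : capInf c R p ≠ ⊤ := by
  have hs : 0 < p - 1 := sub_pos.2 hp
  refine ne_top_of_le_ne_top (b := ∑ i ∈ Finset.range (c []), (R [i])⁻¹) ?_ ?_
  · refine ENNReal.sum_ne_top.2 fun i hi => ?_
    exact ENNReal.inv_ne_top.2 (hR i (Finset.mem_range.1 hi))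
  · refine sSup_le ?_
    rintro _ ⟨μ, -, hV, rfl⟩
    refine Finset.sum_le_sum fun i hi => ?_
    have hi' := Finset.mem_range.1 hi
    have hray := hV _ (IsRay.consRay hi'
      (isRay_zero (leafless_subtree hc (v := [i]) (IsVtx.root.child hi'))))
    rw [rayPot_consRay] at hray
    have h1 : (μ [i] * R [i]) ^ (p - 1) ≤ 1 := le_self_add.trans hray
    rw [← ENNReal.one_rpow (p - 1), ENNReal.rpow_le_rpow_iff hs] at h1
    exact ENNReal.le_inv_iff_mul_le.2 h1

/-- Rescaling a flow whose potential is at most `K` gives an admissible flow. -/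
lemma inv_rpow_mul_flowMass_le_capInf {p : ℝ} (hp : 1 < p) {c : Vtx → ℕ} {μ R : Vtx → ℝ≥0∞}
    (hμ : IsFlow c μ) {K : ℝ≥0∞} (hK : ∀ y, IsRay c y → rayPot μ R (p - 1) y ≤ K) :
    K⁻¹ ^ (1 / (p - 1)) * flowMass c μ ≤ capInf c R p := by
  have hs : 0 < p - 1 := sub_pos.2 hp
  refine le_sSup ⟨fun v => K⁻¹ ^ (1 / (p - 1)) * μ v, ?_, ?_, ?_⟩
  · intro v hv h0 hl
    rw [← Finset.mul_sum, ← hμ v hv h0 hl]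
  · intro y hy
    have : rayPot (fun v => K⁻¹ ^ (1 / (p - 1)) * μ v) R (p - 1) y =
        K⁻¹ * rayPot μ R (p - 1) y := by
      unfold rayPot
      rw [← ENNReal.tsum_mul_left]
      refine tsum_congr fun n => ?_
      rw [mul_assoc, ENNReal.mul_rpow_of_nonneg _ _ hs.le, ← ENNReal.rpow_mul,
        one_div_mul_cancel hs.ne', ENNReal.rpow_one]
    rw [this]
    calc K⁻¹ * rayPot μ R (p - 1) y ≤ K⁻¹ * K := by gcongr; exact hK y hy
      _ ≤ 1 := ENNReal.inv_mul_le_one K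
  · simp only [flowMass, Finset.mul_sum]

lemma le_div_rpow_of_inv_rpow_mul_le {s : ℝ} (hs : 0 < s) {m r C : ℝ≥0∞} (hC : C ≠ ⊤)
    (hr : r ≠ ⊤) (hq : (m * r) ^ s ≤ 1)
    (h : (1 - (m * r) ^ s)⁻¹ ^ (1 / s) * m ≤ C) :
    m ≤ C / (1 + (r * C) ^ s) ^ (1 / s) := by
  set q := (m * r) ^ s with hqdef
  have h1s : 0 < 1 / s := one_div_pos.2 hs
  have hD : (1 + (r * C) ^ s) ^ (1 / s) ≠ ⊤ := by
    have : (r * C) ^ s ≠ ⊤ := ENNReal.rpow_ne_top_of_nonneg hs.le (ENNReal.mul_ne_top hr hC)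
    exact ENNReal.rpow_ne_top_of_nonneg h1s.le (ENNReal.add_ne_top.2 ⟨ENNReal.one_ne_top, this⟩)
  have hD0 : (1 + (r * C) ^ s) ^ (1 / s) ≠ 0 := by
    simp [ENNReal.rpow_eq_zero_iff, hs.le]
  rcases eq_or_ne (1 - q) 0 with h0 | h0
  · rw [h0, ENNReal.inv_zero, ENNReal.top_rpow_of_pos h1s] at h
    have : m = 0 := by
      by_contra hm
      rw [ENNReal.top_mul hm] at h
      exact hC (top_le_iff.1 h)
    simp [this]
  have hmC : m ≤ C * (1 - q) ^ (1 / s) := by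
    have ht : (1 - q) ^ (1 / s) ≠ ⊤ :=
      ENNReal.rpow_ne_top_of_nonneg h1s.le (ne_top_of_le_ne_top ENNReal.one_ne_top tsub_le_self)
    have hz : (1 - q) ^ (1 / s) ≠ 0 := by
      rw [Ne, ENNReal.rpow_eq_zero_iff]
      rintro (⟨h', -⟩ | ⟨-, h'⟩)
      · exact h0 h'
      · linarith
    rw [ENNReal.inv_rpow, mul_comm, ← div_eq_mul_inv] at h
    exact (ENNReal.div_le_iff hz ht).1 h
  have hms : m ^ s ≤ C ^ s * (1 - q) := by
    calc m ^ s ≤ (C * (1 - q) ^ (1 / s)) ^ s := ENNReal.rpow_le_rpow hmC hs.le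
      _ = C ^ s * (1 - q) := by
        rw [ENNReal.mul_rpow_of_nonneg _ _ hs.le, ← ENNReal.rpow_mul,
          one_div_mul_cancel hs.ne', ENNReal.rpow_one]
  rw [ENNReal.le_div_iff_mul_le (Or.inl hD0) (Or.inl hD), ← ENNReal.rpow_le_rpow_iff hs,
    ENNReal.mul_rpow_of_nonneg _ _ hs.le, ← ENNReal.rpow_mul, one_div_mul_cancel hs.ne',
    ENNReal.rpow_one]
  calc m ^ s * (1 + (r * C) ^ s) = m ^ s + C ^ s * q := by
        rw [hqdef, ENNReal.mul_rpow_of_nonneg _ _ hs.le, ENNReal.mul_rpow_of_nonneg _ _ hs.le]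
        ring
    _ ≤ C ^ s * (1 - q) + C ^ s * q := by gcongr
    _ = C ^ s := by rw [← mul_add, tsub_add_cancel_of_le hq, mul_one]

/-- The capacity of a tree is bounded by the combined capacities of its first-level subtrees. -/
lemma capInf_le_sum {p : ℝ} (hp : 1 < p) {c : Vtx → ℕ} (hc : ∀ v, IsVtx c v → 1 ≤ c v)
    {R : Vtx → ℝ≥0∞} (hR0 : ∀ v, IsVtx c v → R v ≠ 0) (hR : ∀ v, IsVtx c v → R v ≠ ⊤) :
    capInf c R p ≤ ∑ i ∈ Finset.range (c []),
      capInf (fun w => c ([i] ++ w)) (fun w => R ([i] ++ w)) p /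
        (1 + (R [i] * capInf (fun w => c ([i] ++ w)) (fun w => R ([i] ++ w)) p) ^ (p - 1)) ^
          (1 / (p - 1)) := by
  have hs : 0 < p - 1 := sub_pos.2 hp
  refine sSup_le ?_
  rintro _ ⟨μ, hμ, hV, rfl⟩
  refine Finset.sum_le_sum fun i hi => ?_
  have hi' := Finset.mem_range.1 hi
  have hvi : IsVtx c [i] := IsVtx.root.child hi'
  have hpot : ∀ y, IsRay (fun w => c ([i] ++ w)) y → (μ [i] * R [i]) ^ (p - 1) +
      rayPot (fun w => μ ([i] ++ w)) (fun w => R ([i] ++ w)) (p - 1) y ≤ 1 := fun y hy => by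
    rw [← rayPot_consRay]; exact hV _ (hy.consRay hi')
  have hq : (μ [i] * R [i]) ^ (p - 1) ≤ 1 :=
    le_self_add.trans (hpot _ (isRay_zero (leafless_subtree hc hvi)))
  have hflow : IsFlow (fun w => c ([i] ++ w)) (fun w => μ ([i] ++ w)) := by
    intro w hw _ hl
    simpa using hμ _ (hvi.append hw) (by simp) hl
  have hmass : flowMass (fun w => c ([i] ++ w)) (fun w => μ ([i] ++ w)) = μ [i] :=
    (hμ [i] hvi (by simp) (Nat.one_le_iff_ne_zero.1 (hc _ hvi))).symm
  have hcap := inv_rpow_mul_flowMass_le_capInf (R := fun w => R ([i] ++ w)) hp hflow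
    (K := 1 - (μ [i] * R [i]) ^ (p - 1)) fun y hy =>
      ENNReal.le_sub_of_add_le_left (ne_top_of_le_ne_top ENNReal.one_ne_top hq) (hpot y hy)
  rw [hmass] at hcap
  exact le_div_rpow_of_inv_rpow_mul_le hs
    (capInf_ne_top hp (leafless_subtree hc hvi) fun j hj => hR0 _ (hvi.child hj))
    (hR _ hvi) hq hcap

/-- A subsolution `b` of the capacity recursion bounds the capacity from below: the flow that
splits at each vertex in proportion to the terms of the recursion is admissible. -/
lemma ofReal_le_capInf {p : ℝ} (hp : 1 < p) {c : Vtx → ℕ} {a : Vtx → ℝ}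
    (ha : ∀ v, IsVtx c v → v ≠ [] → 0 < a v) {R : Vtx → ℝ≥0∞}
    (hR : ∀ v, IsVtx c v → R v = (ENNReal.ofReal (pathProd a v))⁻¹)
    {b : Vtx → ℝ} (hb0 : ∀ v, IsVtx c v → 0 ≤ b v)
    (hb : ∀ v, IsVtx c v → b v ≤ ∑ i ∈ Finset.range (c v),
      a (v ++ [i]) * b (v ++ [i]) / (1 + b (v ++ [i]) ^ (p - 1)) ^ (1 / (p - 1))) :
    ENNReal.ofReal (b []) ≤ capInf c R p := by
  have hs : 0 < p - 1 := sub_pos.2 hp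
  set s := p - 1
  set D : Vtx → ℝ := fun w => (1 + b w ^ s) ^ (1 / s) with hD
  set S : Vtx → ℝ := fun v =>
    ∑ i ∈ Finset.range (c v), a (v ++ [i]) * b (v ++ [i]) / D (v ++ [i]) with hS
  set u : Vtx → ℝ := pathProd fun w => b w.dropLast / S w.dropLast / D w with hu
  have hbS : ∀ v, IsVtx c v → b v ≤ S v := hb
  have hratio0 : ∀ v, IsVtx c v → 0 ≤ b v / S v := fun v hv =>
    div_nonneg (hb0 v hv) ((hb0 v hv).trans (hbS v hv))
  have hratio1 : ∀ v, IsVtx c v → b v / S v ≤ 1 := fun v hv =>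
    div_le_one_of_le₀ (hbS v hv) ((hb0 v hv).trans (hbS v hv))
  have hDpos : ∀ v, IsVtx c v → 0 < D v := fun v hv => by
    have := Real.rpow_nonneg (hb0 v hv) s
    simp only [hD]; positivity
  have hu_succ : ∀ v i, u (v ++ [i]) = u v * (b v / S v / D (v ++ [i])) := fun v i => by
    simp [hu]
  have hu0 : ∀ v, IsVtx c v → 0 ≤ u v := by
    intro v hv
    induction hv with
    | root => simp [hu]
    | child hv hi ih =>
      rw [hu_succ]
      exact mul_nonneg ih (div_nonneg (hratio0 _ hv) (hDpos _ (hv.child hi)).le)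
  have hA := fun v (hv : IsVtx c v) => pathProd_pos ha hv
  set m : Vtx → ℝ := fun v => u v * b v * pathProd a v with hm
  have hm0 : ∀ v, IsVtx c v → 0 ≤ m v := fun v hv =>
    mul_nonneg (mul_nonneg (hu0 v hv) (hb0 v hv)) (hA v hv).le
  have hcons : ∀ v, IsVtx c v →
      ENNReal.ofReal (m v) = ∑ i ∈ Finset.range (c v), ENNReal.ofReal (m (v ++ [i])) := by
    intro v hv
    rw [← ENNReal.ofReal_sum_of_nonneg fun i hi => hm0 _ (hv.child (Finset.mem_range.1 hi))]
    congr 1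
    calc m v = u v * pathProd a v * (b v / S v) * S v := by
          have : b v / S v * S v = b v := by
            refine div_mul_cancel_of_imp fun h0 => ?_
            exact le_antisymm (h0 ▸ hbS v hv) (hb0 v hv)
          rw [mul_assoc _ (b v / S v), this]; simp only [hm]; ring
      _ = _ := by
          rw [hS, Finset.mul_sum]
          refine Finset.sum_congr rfl fun i _ => ?_
          simp only [hm, hu_succ, pathProd_append_singleton]
          ring
  have hstep : ∀ v i, IsVtx c v → i < c v →
      (u (v ++ [i]) * b (v ++ [i])) ^ s + u (v ++ [i]) ^ s ≤ u v ^ s := by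
    intro v i hv hi
    have hw := hv.child hi
    have hbw := Real.rpow_nonneg (hb0 _ hw) s
    have hDs : D (v ++ [i]) ^ s = 1 + b (v ++ [i]) ^ s := by
      simp only [hD]
      rw [← Real.rpow_mul (by positivity), one_div_mul_cancel hs.ne', Real.rpow_one]
    calc (u (v ++ [i]) * b (v ++ [i])) ^ s + u (v ++ [i]) ^ s
        = (u (v ++ [i]) * D (v ++ [i])) ^ s := by
          rw [Real.mul_rpow (hu0 _ hw) (hb0 _ hw), Real.mul_rpow (hu0 _ hw) (hDpos _ hw).le, hDs]
          ring
      _ = (u v * (b v / S v)) ^ s := by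
          rw [hu_succ, mul_assoc, div_mul_cancel₀ _ (hDpos _ hw).ne']
      _ ≤ u v ^ s := by
          refine Real.rpow_le_rpow (mul_nonneg (hu0 v hv) (hratio0 v hv)) ?_ hs.le
          exact mul_le_of_le_one_right (hu0 v hv) (hratio1 v hv)
  refine le_sSup ⟨fun v => ENNReal.ofReal (m v), fun v hv _ _ => hcons v hv, ?_, ?_⟩
  · intro y hy
    refine ENNReal.tsum_le_of_sum_range_le fun N => ?_
    have hterm : ∀ v, IsVtx c v →
        (ENNReal.ofReal (m v) * R v) ^ s = ENNReal.ofReal ((u v * b v) ^ s) := by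
      intro v hv
      rw [hR v hv, ← ENNReal.ofReal_inv_of_pos (hA v hv), ← ENNReal.ofReal_mul (hm0 v hv),
        ENNReal.ofReal_rpow_of_nonneg
          (mul_nonneg (hm0 v hv) (inv_nonneg.2 (hA v hv).le)) hs.le]
      simp only [hm]
      rw [mul_inv_cancel_right₀ (hA v hv).ne']
    rw [Finset.sum_congr rfl fun n _ => hterm _ (hy.isVtx (n + 1)),
      ← ENNReal.ofReal_sum_of_nonneg fun n _ => Real.rpow_nonneg
        (mul_nonneg (hu0 _ (hy.isVtx _)) (hb0 _ (hy.isVtx _))) s]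
    refine ENNReal.ofReal_le_one.2 ?_
    have hsum : ∀ N, ∑ n ∈ Finset.range N, (u ((List.range (n + 1)).map y) *
        b ((List.range (n + 1)).map y)) ^ s + u ((List.range N).map y) ^ s ≤ 1 := by
      intro N
      induction N with
      | zero => simp [hu]
      | succ N ih =>
        have h := hstep _ _ (hy.isVtx N) (hy N)
        rw [← map_range_succ] at h
        rw [Finset.sum_range_succ]
        linarith
    linarith [hsum N, Real.rpow_nonneg (hu0 _ (hy.isVtx N)) s]
  · have h := hcons [] IsVtx.root
    rw [show m [] = b [] by simp [hm, hu]] at h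
    exact h

lemma div_one_add_rpow_le {s κ t t' : ℝ} (hs : 0 < s) (hκ : 0 < κ) (ht : 0 ≤ t) (h : t ≤ t') :
    t / (1 + (κ * t) ^ s) ^ (1 / s) ≤ t' / (1 + (κ * t') ^ s) ^ (1 / s) := by
  have ht' := ht.trans h
  have e : ∀ {x y : ℝ}, 0 ≤ x → 0 ≤ y →
      x * (1 + (κ * y) ^ s) ^ (1 / s) = (x ^ s + (κ * x * y) ^ s) ^ (1 / s) := by
    intro x y hx hy
    have hx' : x = (x ^ s) ^ (1 / s) := by
      rw [← Real.rpow_mul hx, mul_one_div_cancel hs.ne', Real.rpow_one]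
    nth_rewrite 1 [hx']
    rw [← Real.mul_rpow (by positivity) (by positivity), mul_add, mul_one,
      ← Real.mul_rpow hx (by positivity), mul_left_comm x κ y, ← mul_assoc κ x y]
  rw [div_le_div_iff₀ (by positivity) (by positivity), e ht ht', e ht' ht]
  refine Real.rpow_le_rpow (by positivity) ?_ (by positivity)
  rw [mul_right_comm κ t' t]
  gcongr

lemma ofReal_gain {s α κ t : ℝ} (hs : 0 < s) (hα : 0 ≤ α) (hκ : 0 ≤ κ) (ht : 0 ≤ t) :
    ENNReal.ofReal (α * t / (1 + (κ * t) ^ s) ^ (1 / s)) =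
      ENNReal.ofReal α * ENNReal.ofReal t /
        (1 + (ENNReal.ofReal κ * ENNReal.ofReal t) ^ s) ^ (1 / s) := by
  rw [ENNReal.ofReal_div_of_pos (by positivity), ENNReal.ofReal_mul hα,
    ← ENNReal.ofReal_mul hκ, ENNReal.ofReal_rpow_of_nonneg (by positivity) hs.le,
    ← ENNReal.ofReal_one, ← ENNReal.ofReal_add zero_le_one (by positivity),
    ENNReal.ofReal_rpow_of_nonneg (by positivity) (by positivity)]

theorem stmt9 (p s : ℝ) (hp : 1 < p) (hs : s = p - 1)
    (c : Vtx → ℕ) (hleafless : ∀ v, IsVtx c v → 1 ≤ c v)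
    (a : Vtx → ℝ) (ha : ∀ v, IsVtx c v → v ≠ [] → 0 < a v)
    (f : Vtx → ℝ → ℝ)
    (hf0 : ∀ v, IsVtx c v → v ≠ [] → ∀ x : ℝ, 0 ≤ x → 0 ≤ f v x)
    (R : Vtx → ℝ≥0∞)
    (hRdef : ∀ v : Vtx,
      R v = (∏ k ∈ Finset.range v.length, ENNReal.ofReal (a (v.take (k + 1))))⁻¹) :
    -- (a)
    (∀ κ₁ : ℝ, 0 < κ₁ →
      (∀ v, IsVtx c v → v ≠ [] → ∀ t : ℝ, 0 ≤ t →
          f v t ≤ a v * t / (1 + (κ₁ * t) ^ s) ^ (1 / s)) →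
      ∀ x : Vtx → ℝ, (∀ v, IsVtx c v → 0 ≤ x v) →
      (∀ v, IsVtx c v →
        x v ≤ ∑ i ∈ Finset.range (c v), f (v ++ [i]) (x (v ++ [i]))) →
      ENNReal.ofReal (κ₁ * x []) ≤ capInf c R p ∧
        (capInf c R p = 0 → ∀ v, IsVtx c v → x v = 0)) ∧
    -- (b)
    (∀ κ₂ : ℝ, 0 < κ₂ →
      (∀ v, IsVtx c v → v ≠ [] → ∀ t : ℝ, 0 ≤ t →
          a v * t / (1 + (κ₂ * t) ^ s) ^ (1 / s) ≤ f v t) →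
      0 < capInf c R p →
      (∀ v, IsVtx c v →
        R v * capInf (fun w => c (v ++ w)) (fun w => R (v ++ w)) p / ENNReal.ofReal κ₂ ≤
          ∑ i ∈ Finset.range (c v),
            extLiminf (f (v ++ [i]))
              (R (v ++ [i]) *
                  capInf (fun w => c (v ++ [i] ++ w)) (fun w => R (v ++ [i] ++ w)) p /
                ENNReal.ofReal κ₂)) ∧
      capInf c R p ≤ ENNReal.ofReal κ₂ *
        (R [] * capInf (fun w => c ([] ++ w)) (fun w => R ([] ++ w)) p /
          ENNReal.ofReal κ₂)) := by
  subst hs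
  have hs : 0 < p - 1 := sub_pos.2 hp
  have hR : ∀ v, IsVtx c v → R v = (ENNReal.ofReal (pathProd a v))⁻¹ := fun v hv => by
    rw [hRdef, prod_ofReal_eq_ofReal_pathProd ha hv]
  have hR0 : ∀ v, IsVtx c v → R v ≠ 0 := fun v hv => by
    rw [hR v hv]; exact ENNReal.inv_ne_zero.2 ENNReal.ofReal_ne_top
  have hRtop : ∀ v, IsVtx c v → R v ≠ ⊤ := fun v hv => by
    rw [hR v hv]
    exact ENNReal.inv_ne_top.2 (ENNReal.ofReal_pos.2 (pathProd_pos ha hv)).ne'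
  refine ⟨fun κ hκ hf x hx0 hx => ?_, fun κ hκ hf _ => ⟨fun v hv => ?_, ?_⟩⟩
  · set g : Vtx → ℝ → ℝ := fun v t => a v * t / (1 + (κ * t) ^ (p - 1)) ^ (1 / (p - 1)) with hg
    have key : ∀ z : Vtx → ℝ, (∀ v, IsVtx c v → 0 ≤ z v) →
        (∀ v, IsVtx c v → z v ≤ ∑ i ∈ Finset.range (c v), g (v ++ [i]) (z (v ++ [i]))) →
        ENNReal.ofReal (κ * z []) ≤ capInf c R p := by
      intro z hz0 hz
      refine ofReal_le_capInf hp ha hR (b := fun v => κ * z v)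
        (fun v hv => mul_nonneg hκ.le (hz0 v hv)) fun v hv => ?_
      refine (mul_le_mul_of_nonneg_left (hz v hv) hκ.le).trans_eq ?_
      rw [Finset.mul_sum]
      refine Finset.sum_congr rfl fun i _ => ?_
      simp only [hg]
      ring
    have hxg : ∀ v, IsVtx c v →
        x v ≤ ∑ i ∈ Finset.range (c v), g (v ++ [i]) (x (v ++ [i])) := fun v hv =>
      (hx v hv).trans <| Finset.sum_le_sum fun i hi => by
        have hw := hv.child (Finset.mem_range.1 hi)
        exact hf _ hw (by simp) _ (hx0 _ hw)
    refine ⟨key x hx0 hxg, fun hcap v hv => ?_⟩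
    clear hx
    induction hv generalizing x with
    | root =>
      have h := key x hx0 hxg
      rw [hcap, nonpos_iff_eq_zero, ENNReal.ofReal_eq_zero] at h
      exact le_antisymm (nonpos_of_mul_nonpos_right h hκ) (hx0 _ IsVtx.root)
    | @child v i hv hi ih =>
      have hg0 : ∀ z : Vtx → ℝ, (∀ v, IsVtx c v → 0 ≤ z v) → ∀ v, IsVtx c v → ∀ i < c v,
          0 ≤ g (v ++ [i]) (z (v ++ [i])) := fun z hz0 v hv i hi => by
        have hw := hv.child hi
        have h1 := ha _ hw (by simp)
        have h2 := hz0 _ hw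
        simp only [hg]; positivity
      have h := ih (fun v => ∑ i ∈ Finset.range (c v), g (v ++ [i]) (x (v ++ [i])))
        (fun v hv => Finset.sum_nonneg fun i hi => hg0 x hx0 v hv i (Finset.mem_range.1 hi))
        fun v hv => Finset.sum_le_sum fun i hi => by
          have hw := hv.child (Finset.mem_range.1 hi)
          have hmono := mul_le_mul_of_nonneg_left
            (div_one_add_rpow_le hs hκ (hx0 _ hw) (hxg _ hw)) (ha _ hw (by simp)).le
          rwa [← mul_div_assoc, ← mul_div_assoc] at hmono
      have hi0 := (Finset.sum_eq_zero_iff_of_nonneg fun i hi =>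
        hg0 x hx0 v hv i (Finset.mem_range.1 hi)).1 h i (Finset.mem_range.2 hi)
      have hw := hv.child hi
      have h2 := hx0 _ hw
      have hD : (1 + (κ * x (v ++ [i])) ^ (p - 1)) ^ (1 / (p - 1)) ≠ 0 := by positivity
      exact (mul_eq_zero.1 ((div_eq_zero_iff.1 hi0).resolve_right hD)).resolve_left
        (ha _ hw (by simp)).ne'
  · have hκ0 : ENNReal.ofReal κ ≠ 0 := (ENNReal.ofReal_pos.2 hκ).ne'
    have hcap := capInf_le_sum hp (leafless_subtree hleafless hv) (R := fun w => R (v ++ w))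
      (fun w hw => hR0 _ (hv.append hw)) fun w hw => hRtop _ (hv.append hw)
    simp only [← List.append_assoc, List.append_nil] at hcap
    rw [mul_div_assoc]
    refine (mul_le_mul' le_rfl (ENNReal.div_le_div_right hcap _)).trans ?_
    rw [ENNReal.div_eq_inv_mul, Finset.mul_sum, Finset.mul_sum]
    refine Finset.sum_le_sum fun i hi => ?_
    have hi' := Finset.mem_range.1 hi
    have hw := hv.child hi'
    have haw := ha _ hw (by simp)
    set C := capInf (fun w => c (v ++ [i] ++ w)) (fun w => R (v ++ [i] ++ w)) p
    have hCtop : C ≠ ⊤ := capInf_ne_top hp (leafless_subtree hleafless hw) fun j hj =>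
      hR0 _ (hw.child (by simpa using hj))
    set t := R (v ++ [i]) * C / ENNReal.ofReal κ with ht
    have httop : t ≠ ⊤ := ENNReal.div_ne_top (ENNReal.mul_ne_top (hRtop _ hw) hCtop) hκ0
    have hκt : ENNReal.ofReal κ * t = R (v ++ [i]) * C :=
      ENNReal.mul_div_cancel hκ0 ENNReal.ofReal_ne_top
    have hRv : R v = ENNReal.ofReal (a (v ++ [i])) * R (v ++ [i]) := by
      have h0 := (ENNReal.ofReal_pos.2 haw).ne'
      rw [hR v hv, hR _ hw, pathProd_append_singleton, mul_comm (pathProd a v),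
        ENNReal.ofReal_mul haw.le, ENNReal.mul_inv (Or.inl h0) (Or.inl ENNReal.ofReal_ne_top),
        ← mul_assoc, ENNReal.mul_inv_cancel h0 ENNReal.ofReal_ne_top, one_mul]
    have hgain := ofReal_gain hs haw.le hκ.le (ENNReal.toReal_nonneg (a := t))
    rw [ENNReal.ofReal_toReal httop, hκt] at hgain
    rw [extLiminf, if_neg httop]
    refine le_trans (le_of_eq ?_)
      (ENNReal.ofReal_le_ofReal (hf _ hw (by simp) _ ENNReal.toReal_nonneg))
    rw [hgain, hRv, ht]
    simp only [div_eq_mul_inv]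
    ring
  · have hR1 : R [] = 1 := by rw [hRdef]; simp
    simp only [hR1, List.nil_append, one_mul]
    rw [ENNReal.mul_div_cancel (ENNReal.ofReal_pos.2 hκ).ne' ENNReal.ofReal_ne_top]
end
end

section
/- For θ ∈ (0,1) define g_θ(x) = (f_θ(√x))², where f_θ(x) = log[(cosh(x/2) + θ sinh(x/2)) / (cosh(x/2) − θ sinh(x/2))]. For every c ≥ 1 there exist continuous functions κ₂(c,θ) ≥ κ₁(c,θ) > 0 of θ ∈ (0,1) such that, for every nonnegative integrable random variable V with E[V²] ≤ c (E[V])², one has θ² E[V] / (1 + κ₂(c,θ) E[V]) ≤ E[g_θ(V)] ≤ θ² E[V] / (1 + κ₁(c,θ) E[V]). -/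
open MeasureTheory

noncomputable section

/-- `f_θ(x) = log[(cosh(x/2) + θ sinh(x/2)) / (cosh(x/2) − θ sinh(x/2))]`. -/
def fbias (θ x : ℝ) : ℝ :=
  Real.log ((Real.cosh (x / 2) + θ * Real.sinh (x / 2)) /
    (Real.cosh (x / 2) - θ * Real.sinh (x / 2)))

/-- `g_θ(x) = (f_θ(√x))²`. -/
def gbias (θ x : ℝ) : ℝ := (fbias θ (Real.sqrt x)) ^ 2

lemma abs_mul_sinh_lt_cosh {θ : ℝ} (hθ : θ ∈ Set.Ioo (0 : ℝ) 1) (y : ℝ) :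
    |θ * Real.sinh y| < Real.cosh y := by
  have h : θ ^ 2 < 1 := by nlinarith [hθ.1, hθ.2]
  refine abs_lt_of_sq_lt_sq ?_ (Real.cosh_pos y).le
  nlinarith [Real.cosh_sq y, sq_nonneg (Real.sinh y)]

lemma fbias_eq_log_sub_log {θ : ℝ} (hθ : θ ∈ Set.Ioo (0 : ℝ) 1) (x : ℝ) :
    fbias θ x = Real.log (Real.cosh (x / 2) + θ * Real.sinh (x / 2)) -
      Real.log (Real.cosh (x / 2) - θ * Real.sinh (x / 2)) := by
  have h := abs_lt.1 (abs_mul_sinh_lt_cosh hθ (x / 2))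
  exact Real.log_div (by linarith [h.1]) (by linarith [h.2])

lemma hasDerivAt_fbias {θ : ℝ} (hθ : θ ∈ Set.Ioo (0 : ℝ) 1) (x : ℝ) :
    HasDerivAt (fbias θ) (θ / (1 + (1 - θ ^ 2) * Real.sinh (x / 2) ^ 2)) x := by
  have h := abs_lt.1 (abs_mul_sinh_lt_cosh hθ (x / 2))
  have h1 : Real.cosh (x / 2) + θ * Real.sinh (x / 2) ≠ 0 := by linarith [h.1]
  have h2 : Real.cosh (x / 2) - θ * Real.sinh (x / 2) ≠ 0 := by linarith [h.2]
  have hx : HasDerivAt (fun x : ℝ => x / 2) (1 / 2) x := (hasDerivAt_id x).div_const 2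
  have hc := hx.cosh
  have hs := hx.sinh.const_mul θ
  rw [funext (fbias_eq_log_sub_log hθ)]
  refine (((hc.fun_add hs).log h1).fun_sub ((hc.fun_sub hs).log h2)).congr_deriv ?_
  have h3 : 1 + (1 - θ ^ 2) * Real.sinh (x / 2) ^ 2 =
      (Real.cosh (x / 2) + θ * Real.sinh (x / 2)) *
        (Real.cosh (x / 2) - θ * Real.sinh (x / 2)) := by
    linear_combination -Real.cosh_sq (x / 2)
  rw [h3, div_sub_div _ _ h1 h2]
  congr 1
  linear_combination θ * Real.cosh_sq (x / 2)

lemma sq_add_le_sinh_half_sq (x : ℝ) :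
    x ^ 2 / 4 + x ^ 4 / 48 ≤ Real.sinh (x / 2) ^ 2 := by
  have h := sum_le_hasSum (Finset.range 3)
    (fun n _ => div_nonneg ((even_two_mul n).pow_nonneg x) (Nat.cast_nonneg _))
    (Real.hasSum_cosh x)
  norm_num [Finset.sum_range_succ, Nat.factorial] at h
  have h2 := Real.cosh_two_mul (x / 2)
  rw [mul_div_cancel₀ x two_ne_zero, Real.cosh_sq] at h2
  linarith

lemma fbias_le {θ : ℝ} (hθ : θ ∈ Set.Ioo (0 : ℝ) 1) {x : ℝ} (hx : 0 ≤ x) :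
    fbias θ x ≤ θ * (x / √(1 + (1 - θ ^ 2) / 6 * x ^ 2)) := by
  have hb : 0 < 1 - θ ^ 2 := by nlinarith [hθ.1, hθ.2]
  have hb1 : 1 - θ ^ 2 < 1 := by nlinarith [hθ.1]
  set b := 1 - θ ^ 2 with hbdef
  have hpos (x : ℝ) : 0 < 1 + b / 6 * x ^ 2 := by positivity
  have hF (x : ℝ) : HasDerivAt (fun x => θ * (x / √(1 + b / 6 * x ^ 2)))
      (θ / √(1 + b / 6 * x ^ 2) ^ 3) x := by
    have hq : HasDerivAt (fun x : ℝ => 1 + b / 6 * x ^ 2) (b / 6 * (2 * x)) x := by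
      simpa using ((hasDerivAt_pow 2 x).const_mul (b / 6)).const_add 1
    have hw := Real.sqrt_pos.2 (hpos x)
    refine (((hasDerivAt_id x).div (hq.sqrt (hpos x).ne') hw.ne').const_mul θ).congr_deriv ?_
    have hsq := Real.sq_sqrt (hpos x).le
    simp only [id]
    set w := √(1 + b / 6 * x ^ 2)
    field_simp
    linear_combination 6 * θ * hsq
  have hcmp (x : ℝ) : √(1 + b / 6 * x ^ 2) ^ 3 ≤ 1 + b * Real.sinh (x / 2) ^ 2 := by
    have hs : 1 + b * (x ^ 2 / 4 + x ^ 4 / 48) ≤ 1 + b * Real.sinh (x / 2) ^ 2 := by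
      gcongr
      exact sq_add_le_sinh_half_sq x
    refine le_trans (le_of_sq_le_sq ?_ (by positivity)) hs
    rw [pow_right_comm, Real.sq_sqrt (hpos x).le]
    have hz : (0 : ℝ) ≤ x ^ 2 := sq_nonneg x
    rw [show x ^ 4 = (x ^ 2) ^ 2 by ring]
    generalize x ^ 2 = z at hz
    have e : (1 + b * (z / 4 + z ^ 2 / 48)) ^ 2 - (1 + b / 6 * z) ^ 3 =
        (b / 24 * (1 - b) + b ^ 2 / 48) * z ^ 2 + b ^ 2 * (1 / 96 - b / 216) * z ^ 3 +
          b ^ 2 / 2304 * z ^ 4 := by ring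
    have h1 : 0 ≤ 1 - b := by linarith
    have h2 : 0 ≤ 1 / 96 - b / 216 := by linarith
    have : 0 ≤ (1 + b * (z / 4 + z ^ 2 / 48)) ^ 2 - (1 + b / 6 * z) ^ 3 := by
      rw [e]; positivity
    linarith
  have hD (x : ℝ) := (hF x).sub (hasDerivAt_fbias hθ x)
  have hmono := monotone_of_hasDerivAt_nonneg hD fun x => sub_nonneg.2 <|
    div_le_div_of_nonneg_left hθ.1.le (pow_pos (Real.sqrt_pos.2 (hpos x)) 3) (hcmp x)
  have := hmono hx
  simpa [fbias] using this

lemma two_mul_tanh_le_fbias {θ : ℝ} (hθ : θ ∈ Set.Ioo (0 : ℝ) 1) {x : ℝ} (hx : 0 ≤ x) :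
    2 * (θ * Real.sinh (x / 2) / Real.cosh (x / 2)) ≤ fbias θ x := by
  have hc := Real.cosh_pos (x / 2)
  have h := abs_mul_sinh_lt_cosh hθ (x / 2)
  have hs : 0 ≤ Real.sinh (x / 2) := Real.sinh_nonneg_iff.2 (by positivity)
  have hu0 : 0 ≤ θ * Real.sinh (x / 2) / Real.cosh (x / 2) :=
    div_nonneg (mul_nonneg hθ.1.le hs) hc.le
  have hu1 : |θ * Real.sinh (x / 2) / Real.cosh (x / 2)| < 1 := by
    rwa [abs_div, abs_of_pos hc, div_lt_one hc]
  have h1 := le_hasSum (Real.hasSum_log_sub_log_of_abs_lt_one hu1) 0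
    (fun n _ => by positivity)
  have h2 := abs_lt.1 hu1
  have e : fbias θ x = Real.log (1 + θ * Real.sinh (x / 2) / Real.cosh (x / 2)) -
      Real.log (1 - θ * Real.sinh (x / 2) / Real.cosh (x / 2)) := by
    rw [← Real.log_div (by linarith [h2.1]) (by linarith [h2.2]), fbias]
    congr 1
    field_simp
  rw [e]
  simpa using h1

lemma gbias_le {θ : ℝ} (hθ : θ ∈ Set.Ioo (0 : ℝ) 1) {x : ℝ} (hx : 0 ≤ x) :
    gbias θ x ≤ θ ^ 2 * (x / (1 + (1 - θ ^ 2) / 6 * x)) := by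
  have hb : 0 < 1 - θ ^ 2 := by nlinarith [hθ.1, hθ.2]
  have hf0 : 0 ≤ fbias θ √x := by
    refine le_trans ?_ (two_mul_tanh_le_fbias hθ (Real.sqrt_nonneg x))
    have := Real.sinh_nonneg_iff.2 (show 0 ≤ √x / 2 by positivity)
    have := Real.cosh_pos (√x / 2)
    have := hθ.1
    positivity
  refine (pow_le_pow_left₀ hf0 (fbias_le hθ (Real.sqrt_nonneg x)) 2).trans_eq ?_
  rw [mul_pow, div_pow, Real.sq_sqrt hx, Real.sq_sqrt (by positivity)]

lemma le_gbias {θ : ℝ} (hθ : θ ∈ Set.Ioo (0 : ℝ) 1) {x : ℝ} (hx : 0 ≤ x) :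
    θ ^ 2 * (x / (1 + 1 / 4 * x)) ≤ gbias θ x := by
  have hs := Real.sinh_nonneg_iff.2 (show 0 ≤ √x / 2 by positivity)
  have hc := Real.cosh_pos (√x / 2)
  have hθ0 := hθ.1
  refine le_trans ?_ (pow_le_pow_left₀ (by positivity)
    (two_mul_tanh_le_fbias hθ (Real.sqrt_nonneg x)) 2)
  have h := sq_add_le_sinh_half_sq √x
  rw [Real.sq_sqrt hx] at h
  have h4 : 0 ≤ √x ^ 4 := by positivity
  rw [mul_pow, div_pow, mul_pow, Real.cosh_sq, mul_div_assoc, ← mul_assoc, mul_comm (2 ^ 2 : ℝ),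
    mul_assoc]
  gcongr
  rw [← mul_div_assoc, div_le_div_iff₀ (by positivity) (by positivity)]
  nlinarith

lemma measurable_gbias (θ : ℝ) : Measurable (gbias θ) := by
  unfold gbias fbias
  fun_prop

lemma div_one_add_mul_le_tangent {k m x : ℝ} (hk : 0 ≤ k) (hm : 0 ≤ m) (hx : 0 ≤ x) :
    x / (1 + k * x) ≤ m / (1 + k * m) + (x - m) / (1 + k * m) ^ 2 := by
  have e : m / (1 + k * m) + (x - m) / (1 + k * m) ^ 2 - x / (1 + k * x) =
      k * (x - m) ^ 2 / ((1 + k * m) ^ 2 * (1 + k * x)) := by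
    have : 1 + k * m ≠ 0 := by positivity
    have : 1 + k * x ≠ 0 := by positivity
    field_simp
    ring
  rw [← sub_nonneg, e]
  positivity

lemma two_mul_sub_le_div_one_add_mul {k x : ℝ} (hk : 0 ≤ k) (hx : 0 ≤ x) (a : ℝ) :
    2 * a * x - a ^ 2 * (x + k * x ^ 2) ≤ x / (1 + k * x) := by
  have e : x / (1 + k * x) - (2 * a * x - a ^ 2 * (x + k * x ^ 2)) =
      x * (1 - a * (1 + k * x)) ^ 2 / (1 + k * x) := by
    have : 1 + k * x ≠ 0 := by positivity
    field_simp
    ring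
  rw [← sub_nonneg, e]
  positivity

theorem stmt16 (c : ℝ) (hc : 1 ≤ c) :
    ∃ κ₁ κ₂ : ℝ → ℝ,
      ContinuousOn κ₁ (Set.Ioo 0 1) ∧ ContinuousOn κ₂ (Set.Ioo 0 1) ∧
      (∀ θ ∈ Set.Ioo (0 : ℝ) 1, 0 < κ₁ θ ∧ κ₁ θ ≤ κ₂ θ) ∧
      ∀ θ ∈ Set.Ioo (0 : ℝ) 1,
        ∀ (Ω : Type) (_ : MeasurableSpace Ω) (μ : Measure Ω),
          IsProbabilityMeasure μ →
          ∀ V : Ω → ℝ, (∀ ω, 0 ≤ V ω) → Integrable V μ →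
            Integrable (fun ω => (V ω) ^ 2) μ →
            (∫ ω, (V ω) ^ 2 ∂μ) ≤ c * (∫ ω, V ω ∂μ) ^ 2 →
            θ ^ 2 * (∫ ω, V ω ∂μ) / (1 + κ₂ θ * ∫ ω, V ω ∂μ) ≤
                (∫ ω, gbias θ (V ω) ∂μ) ∧
              (∫ ω, gbias θ (V ω) ∂μ) ≤
                θ ^ 2 * (∫ ω, V ω ∂μ) / (1 + κ₁ θ * ∫ ω, V ω ∂μ) := by
  refine ⟨fun θ => (1 - θ ^ 2) / 6, fun _ => c / 4, by fun_prop, by fun_prop,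
    fun θ hθ => ⟨?_, ?_⟩, ?_⟩
  · nlinarith [hθ.1, hθ.2]
  · nlinarith [hθ.1]
  intro θ hθ Ω _ μ _ V hV hVi hV2 hc2
  have hb : 0 < (1 - θ ^ 2) / 6 := by nlinarith [hθ.1, hθ.2]
  have hm : 0 ≤ ∫ ω, V ω ∂μ := integral_nonneg hV
  have hgi : Integrable (fun ω => gbias θ (V ω)) μ := by
    refine (hVi.const_mul (θ ^ 2)).mono'
      ((measurable_gbias θ).comp_aemeasurable hVi.aemeasurable).aestronglyMeasurable
      (.of_forall fun ω => ?_)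
    rw [Real.norm_of_nonneg (show 0 ≤ gbias θ (V ω) from sq_nonneg _)]
    refine (gbias_le hθ (hV ω)).trans ?_
    gcongr
    exact div_le_self (hV ω) (le_add_of_nonneg_right (mul_nonneg hb.le (hV ω)))
  set m := ∫ ω, V ω ∂μ with hmdef
  dsimp only
  constructor
  · set a := 1 / (1 + c / 4 * m) with ha
    have hden : 0 < 1 + c / 4 * m := by positivity
    have hq : Integrable (fun ω => V ω + 1 / 4 * V ω ^ 2) μ := hVi.add (hV2.const_mul _)
    have hi : Integrable (fun ω => 2 * a * V ω - a ^ 2 * (V ω + 1 / 4 * V ω ^ 2)) μ :=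
      (hVi.const_mul _).sub (hq.const_mul _)
    have hle : ∫ ω, θ ^ 2 * (2 * a * V ω - a ^ 2 * (V ω + 1 / 4 * V ω ^ 2)) ∂μ ≤
        ∫ ω, gbias θ (V ω) ∂μ := by
      refine integral_mono (hi.const_mul _) hgi fun ω => ?_
      refine le_trans ?_ (le_gbias hθ (hV ω))
      have := two_mul_sub_le_div_one_add_mul (k := 1 / 4) (by norm_num) (hV ω) a
      exact mul_le_mul_of_nonneg_left this (sq_nonneg θ)
    refine le_trans ?_ hle
    rw [integral_const_mul, integral_sub (hVi.const_mul _) (hq.const_mul _), integral_const_mul, integral_const_mul,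
      integral_add hVi (hV2.const_mul _), integral_const_mul, ← hmdef, mul_div_assoc]
    gcongr
    calc m / (1 + c / 4 * m) = 2 * a * m - a ^ 2 * (m + 1 / 4 * (c * m ^ 2)) := by
          rw [ha]; field_simp; ring
      _ ≤ _ := by gcongr
  · set k := (1 - θ ^ 2) / 6
    have hi : Integrable (fun ω => (V ω - m) / (1 + k * m) ^ 2) μ :=
      (hVi.sub (integrable_const m)).div_const _
    have hle : ∫ ω, gbias θ (V ω) ∂μ ≤
        ∫ ω, θ ^ 2 * (m / (1 + k * m) + (V ω - m) / (1 + k * m) ^ 2) ∂μ := by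
      refine integral_mono hgi (((integrable_const _).add hi).const_mul _) fun ω => ?_
      refine (gbias_le hθ (hV ω)).trans ?_
      exact mul_le_mul_of_nonneg_left (div_one_add_mul_le_tangent hb.le hm (hV ω)) (sq_nonneg θ)
    refine hle.trans_eq ?_
    rw [integral_const_mul, integral_add (integrable_const _) hi, integral_div ((1 + k * m) ^ 2),
      integral_sub hVi (integrable_const m), ← hmdef]
    simp [mul_div_assoc]
end
end
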